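/- Let n ≥ 1 and let (Ω, 𝓕, P) be a probability space equipped with a filtration (𝓕_t)_{t ∈ ℕ}. Let (r_t) be random vectors in ℝ^n and (C_t), (H_t) random n×n real matrices such that, for every t ≥ 1, C_t and H_t are 𝓕_{t-1}-measurable, E[r_t r_tᵀ | 𝓕_{t-1}] = H_t almost surely, and H_t = C Cᵀ + C_t C_tᵀ + a r_{t-1} r_{t-1}ᵀ + b H_{t-1}, where C is a fixed n×n real matrix, a, b ≥ 0 with a + b < 1, and H_0 is deterministic. Assume all matrices involved are integrable and ‖C_t C_tᵀ‖_F ≤ M' almost surely for all t, and set M := ‖C Cᵀ‖_F + M'. Then limsup_{k → ∞} ‖E[H_k]‖_F ≤ M / (1 − a − b). -/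

import Mathlib

open MeasureTheory Matrix

/-- Frobenius norm of an `n × n` real matrix. -/
noncomputable def frobNorm {n : ℕ} (A : Matrix (Fin n) (Fin n) ℝ) : ℝ :=
  Real.sqrt (∑ i, ∑ j, (A i j) ^ 2)

section FrobeniusNorm

attribute [local instance] Matrix.frobeniusNormedAddCommGroup Matrix.frobeniusNormedSpace

lemma frobNorm_eq_norm {n : ℕ} (A : Matrix (Fin n) (Fin n) ℝ) : frobNorm A = ‖A‖ := by
  simp [frobNorm, Matrix.frobenius_norm_def, Real.sqrt_eq_rpow]

lemma frobNorm_nonneg {n : ℕ} (A : Matrix (Fin n) (Fin n) ℝ) : 0 ≤ frobNorm A :=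
  Real.sqrt_nonneg _

lemma frobNorm_add_le {n : ℕ} (A B : Matrix (Fin n) (Fin n) ℝ) :
    frobNorm (A + B) ≤ frobNorm A + frobNorm B := by
  simpa only [frobNorm_eq_norm] using norm_add_le A B

lemma frobNorm_smul {n : ℕ} (c : ℝ) (A : Matrix (Fin n) (Fin n) ℝ) :
    frobNorm (c • A) = |c| * frobNorm A := by
  simpa only [frobNorm_eq_norm, Real.norm_eq_abs] using norm_smul c A

end FrobeniusNorm

lemma frobNorm_sq {n : ℕ} (A : Matrix (Fin n) (Fin n) ℝ) :
    frobNorm A ^ 2 = ∑ i, ∑ j, A i j ^ 2 :=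
  Real.sq_sqrt (by positivity)

lemma sum_mul_le_frobNorm_mul_frobNorm {n : ℕ} (A B : Matrix (Fin n) (Fin n) ℝ) :
    ∑ i, ∑ j, A i j * B i j ≤ frobNorm A * frobNorm B := by
  simpa only [frobNorm, ← Fintype.sum_prod_type'] using
    Real.sum_mul_le_sqrt_mul_sqrt Finset.univ
      (fun p : Fin n × Fin n => A p.1 p.2) (fun p => B p.1 p.2)

lemma frobNorm_integral_le {n : ℕ} {Ω : Type*} {m0 : MeasurableSpace Ω} {μ : Measure Ω}
    [IsProbabilityMeasure μ] {X : Ω → Matrix (Fin n) (Fin n) ℝ} {K : ℝ}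
    (hX : ∀ i j, Integrable (fun x => X x i j) μ) (hK : ∀ᵐ x ∂μ, frobNorm (X x) ≤ K) :
    frobNorm (Matrix.of fun i j => ∫ x, X x i j ∂μ) ≤ K := by
  set S : Matrix (Fin n) (Fin n) ℝ := Matrix.of fun i j => ∫ x, X x i j ∂μ with hS
  have hK0 : 0 ≤ K := by
    obtain ⟨x, hx⟩ := hK.exists
    exact (frobNorm_nonneg _).trans hx
  have hsum : ∀ i, Integrable (fun x => ∑ j, S i j * X x i j) μ := fun i =>
    integrable_finsetSum _ fun j _ => (hX i j).const_mul _
  have hsq : frobNorm S ^ 2 = ∫ x, ∑ i, ∑ j, S i j * X x i j ∂μ := by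
    rw [frobNorm_sq, integral_finsetSum _ fun i _ => hsum i]
    refine Finset.sum_congr rfl fun i _ => ?_
    rw [integral_finsetSum _ fun j _ => (hX i j).const_mul _]
    refine Finset.sum_congr rfl fun j _ => ?_
    rw [integral_const_mul, sq]
    rfl
  have hle : frobNorm S ^ 2 ≤ frobNorm S * K := by
    rw [hsq]
    calc ∫ x, ∑ i, ∑ j, S i j * X x i j ∂μ ≤ ∫ _, frobNorm S * K ∂μ := by
          refine integral_mono_ae (integrable_finsetSum _ fun i _ => hsum i)
            (integrable_const _) ?_
          filter_upwards [hK] with x hx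
          exact (sum_mul_le_frobNorm_mul_frobNorm S (X x)).trans
            (mul_le_mul_of_nonneg_left hx (frobNorm_nonneg S))
      _ = frobNorm S * K := by simp
  nlinarith [frobNorm_nonneg S]

/-- A nonnegative sequence that eventually satisfies an affine contraction inequality has
limsup at most the fixed point of the contraction. -/
lemma limsup_le_of_affine_contraction {u : ℕ → ℝ} {c M : ℝ} (hu : ∀ k, 0 ≤ u k)
    (hc0 : 0 ≤ c) (hc1 : c < 1) (h : ∀ k, 1 ≤ k → u (k + 1) ≤ M + c * u k) :
    Filter.limsup u Filter.atTop ≤ M / (1 - c) := by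
  have hfix : M + c * (M / (1 - c)) = M / (1 - c) := by
    have : 1 - c ≠ 0 := by linarith
    field_simp
    ring
  have hbound : ∀ k, u (k + 1) ≤ c ^ k * (u 1 - M / (1 - c)) + M / (1 - c) := by
    intro k
    induction k with
    | zero => simp
    | succ k ih =>
      calc u (k + 1 + 1) ≤ M + c * u (k + 1) := h _ (Nat.le_add_left _ _)
        _ ≤ M + c * (c ^ k * (u 1 - M / (1 - c)) + M / (1 - c)) := by gcongr
        _ = c ^ (k + 1) * (u 1 - M / (1 - c)) + (M + c * (M / (1 - c))) := by ring
        _ = _ := by rw [hfix]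
  have hlim : Filter.Tendsto (fun k : ℕ => c ^ k * (u 1 - M / (1 - c)) + M / (1 - c))
      Filter.atTop (nhds (M / (1 - c))) := by
    simpa using ((tendsto_pow_atTop_nhds_zero_of_lt_one hc0 hc1).mul_const
      (u 1 - M / (1 - c))).add_const (M / (1 - c))
  rw [← Filter.limsup_nat_add u 1, ← hlim.limsup_eq]
  exact Filter.limsup_le_limsup (Filter.Eventually.of_forall hbound)
    (Filter.isCoboundedUnder_le_of_le _ (x := 0) fun k => hu (k + 1))
    hlim.isBoundedUnder_le

/-- Asymptotic consequence of Theorem 1 of the paper: under the LSTM-BEKK recursion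
with `a, b ≥ 0`, `a + b < 1`, deterministic `H_0` and `‖C_t C_tᵀ‖_F ≤ M'` a.s.,
one has `limsup_{k → ∞} ‖E[H_k]‖_F ≤ M / (1 - a - b)` with `M = ‖C Cᵀ‖_F + M'`. -/
theorem stmt_6 {n : ℕ} (hn : 1 ≤ n)
    {Ω : Type*} {m0 : MeasurableSpace Ω} {μ : Measure Ω} [IsProbabilityMeasure μ]
    (ℱ : Filtration ℕ m0)
    (r : ℕ → Ω → Fin n → ℝ)
    (Cdyn H : ℕ → Ω → Matrix (Fin n) (Fin n) ℝ)
    (C H0 : Matrix (Fin n) (Fin n) ℝ)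
    (a b : ℝ) (ha : 0 ≤ a) (hb : 0 ≤ b) (hab : a + b < 1)
    (hH0 : ∀ x : Ω, H 0 x = H0)
    (hmeasC : ∀ t : ℕ, 1 ≤ t → ∀ i j : Fin n,
      StronglyMeasurable[ℱ (t - 1)] fun x => Cdyn t x i j)
    (hmeasH : ∀ t : ℕ, 1 ≤ t → ∀ i j : Fin n,
      StronglyMeasurable[ℱ (t - 1)] fun x => H t x i j)
    (hcond : ∀ t : ℕ, 1 ≤ t → ∀ i j : Fin n,
      μ[fun x => r t x i * r t x j | ℱ (t - 1)] =ᵐ[μ] fun x => H t x i j)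
    (hrec : ∀ t : ℕ, 1 ≤ t → ∀ x : Ω,
      H t x = C * Cᵀ + Cdyn t x * (Cdyn t x)ᵀ
        + a • vecMulVec (r (t - 1) x) (r (t - 1) x) + b • H (t - 1) x)
    (hint_rr : ∀ t : ℕ, ∀ i j : Fin n, Integrable (fun x => r t x i * r t x j) μ)
    (hint_C : ∀ t : ℕ, ∀ i j : Fin n,
      Integrable (fun x => (Cdyn t x * (Cdyn t x)ᵀ) i j) μ)
    (hint_H : ∀ t : ℕ, ∀ i j : Fin n, Integrable (fun x => H t x i j) μ)
    (M' : ℝ) (hM' : ∀ t : ℕ, ∀ᵐ x ∂μ, frobNorm (Cdyn t x * (Cdyn t x)ᵀ) ≤ M')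
    (M : ℝ) (hM : M = frobNorm (C * Cᵀ) + M') :
    Filter.limsup
        (fun k : ℕ => frobNorm (Matrix.of fun i j : Fin n => ∫ x, H k x i j ∂μ))
        Filter.atTop
      ≤ M / (1 - a - b) := by
  have hE : ∀ k, 1 ≤ k → (Matrix.of fun i j => ∫ x, H (k + 1) x i j ∂μ) =
      C * Cᵀ + (Matrix.of fun i j => ∫ x, (Cdyn (k + 1) x * (Cdyn (k + 1) x)ᵀ) i j ∂μ)
        + (a + b) • (Matrix.of fun i j => ∫ x, H k x i j ∂μ) := by
    intro k hk
    ext i j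
    have hrr : ∫ x, r k x i * r k x j ∂μ = ∫ x, H k x i j ∂μ := by
      rw [← integral_congr_ae (hcond k hk i j), integral_condExp (ℱ.le _)]
    have hpt : ∀ x, H (k + 1) x i j = (C * Cᵀ) i j
        + (Cdyn (k + 1) x * (Cdyn (k + 1) x)ᵀ) i j
        + a * (r k x i * r k x j) + b * H k x i j := by
      intro x
      rw [hrec (k + 1) (Nat.le_add_left _ _) x]
      rfl
    have h1 := integrable_const (μ := μ) ((C * Cᵀ) i j)
    have h2 := hint_C (k + 1) i j
    have h3 := (hint_rr k i j).const_mul a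
    have h4 := (hint_H k i j).const_mul b
    have h12 : Integrable (fun x => (C * Cᵀ) i j
        + (Cdyn (k + 1) x * (Cdyn (k + 1) x)ᵀ) i j) μ := h1.add h2
    have h123 : Integrable (fun x => (C * Cᵀ) i j
        + (Cdyn (k + 1) x * (Cdyn (k + 1) x)ᵀ) i j + a * (r k x i * r k x j)) μ := h12.add h3
    simp only [Matrix.add_apply, Matrix.smul_apply, Matrix.of_apply, smul_eq_mul, hpt]
    rw [integral_add h123 h4, integral_add h12 h3,
      integral_add h1 h2, integral_const_mul, integral_const_mul, hrr]
    simp only [integral_const, probReal_univ, one_smul]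
    ring
  rw [sub_sub]
  refine limsup_le_of_affine_contraction (fun k => frobNorm_nonneg _) (add_nonneg ha hb) hab
    fun k hk => ?_
  rw [hE k hk, hM]
  calc _ ≤ _ := frobNorm_add_le _ _
    _ ≤ _ := add_le_add (frobNorm_add_le _ _) le_rfl
    _ ≤ _ := by
      rw [frobNorm_smul, abs_of_nonneg (add_nonneg ha hb)]
      gcongr
      exact frobNorm_integral_le (hint_C (k + 1)) (hM' (k + 1))
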